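/- If x : [a,b] → ℝ is continuously differentiable and α : [a,b] → (0,1) is differentiable, then for t ∈ (a,b), the type I left Caputo derivative satisfies ᶜₐD_t^{α(t)} x(t) = ᶜₐ𝔻_t^{α(t)} x(t) + (α'(t)/Γ(2-α(t))) ∫_a^t (t-τ)^{1-α(t)} x'(τ) [1/(1-α(t)) - ln(t-τ)] dτ. -/

import Mathlib

open Real intervalIntegral Set

open MeasureTheory Filter Topology

/-- Differentiation under the integral sign, with an integrand that is only required to be
Lipschitz relative to the base point. -/
theorem hasDerivAt_integral_of_dominated_loc_of_lip_base {Ω : Type*} [MeasurableSpace Ω]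
    {μ : Measure Ω} {F : ℝ → Ω → ℝ} {F' bound : Ω → ℝ} {x₀ : ℝ} {s : Set ℝ} (hs : s ∈ 𝓝 x₀)
    (hF_meas : ∀ x ∈ s, AEStronglyMeasurable (F x) μ) (hF_int : Integrable (F x₀) μ)
    (hF'_meas : AEStronglyMeasurable F' μ)
    (h_lipsch : ∀ᵐ ω ∂μ, ∀ x ∈ s, ‖F x ω - F x₀ ω‖ ≤ bound ω * ‖x - x₀‖)
    (bound_integrable : Integrable bound μ)
    (h_diff : ∀ᵐ ω ∂μ, HasDerivAt (F · ω) (F' ω) x₀) :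
    HasDerivAt (fun x ↦ ∫ ω, F x ω ∂μ) (∫ ω, F' ω ∂μ) x₀ := by
  set L : ℝ →L[ℝ] ℝ →L[ℝ] ℝ := ContinuousLinearMap.smulRightL ℝ ℝ ℝ 1
  replace h_diff : ∀ᵐ ω ∂μ, HasFDerivAt (F · ω) (L (F' ω)) x₀ :=
    h_diff.mono fun x hx ↦ hx.hasFDerivAt
  have hm : AEStronglyMeasurable (L ∘ F') μ := L.continuous.comp_aestronglyMeasurable hF'_meas
  obtain ⟨hF'_int, key⟩ := hasFDerivAt_integral_of_dominated_loc_of_lip'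
    hs hF_meas hF_int hm h_lipsch bound_integrable h_diff
  replace hF'_int : Integrable F' μ := by
    rw [← integrable_norm_iff hm] at hF'_int
    rw [← integrable_norm_iff hF'_meas]
    simpa [L, (· ∘ ·)] using! hF'_int
  simp_rw [hasDerivAt_iff_hasFDerivAt] at h_diff ⊢
  simpa only [(· ∘ ·), ContinuousLinearMap.integral_comp_comm _ hF'_int] using! key

theorem rpow_sub_rpow_le_mul_rpow_sub_one {p u v : ℝ} (hp1 : p ≤ 1) (hv : 0 < v)
    (hvu : v ≤ u) : u ^ p - v ^ p ≤ (u - v) * u ^ (p - 1) := by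
  have hu : 0 < u := hv.trans_le hvu
  have h1 : u ^ (p - 1) ≤ v ^ (p - 1) := rpow_le_rpow_of_nonpos hv hvu (by linarith)
  have h2 : u * u ^ (p - 1) = u ^ p := by rw [rpow_sub_one hu.ne']; field_simp
  have h3 : v * v ^ (p - 1) = v ^ p := by rw [rpow_sub_one hv.ne']; field_simp
  nlinarith [mul_le_mul_of_nonneg_left h1 hv.le]

theorem abs_max_rpow_sub_max_rpow_le {p s t τ : ℝ} (hp : 0 < p) (hp1 : p ≤ 1) (hτ : τ ≠ t) :
    |(max (s - τ) 0) ^ p - (max (t - τ) 0) ^ p| ≤ |t - τ| ^ (p - 1) * |s - t| := by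
  have hrhs : 0 ≤ |t - τ| ^ (p - 1) * |s - t| := by positivity
  rcases lt_or_gt_of_ne hτ with h | h
  · have ht : 0 < t - τ := sub_pos.2 h
    rw [max_eq_left ht.le, abs_of_pos ht]
    rcases le_total s t with hst | hst
    · have hle : (max (s - τ) 0) ^ p ≤ (t - τ) ^ p :=
        rpow_le_rpow (le_max_right _ _) (max_le (by linarith) ht.le) hp.le
      rw [abs_sub_comm, abs_of_nonneg (sub_nonneg.2 hle), abs_sub_comm s t,
        abs_of_nonneg (sub_nonneg.2 hst)]
      rcases le_or_gt (s - τ) 0 with h0 | h0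
      · rw [max_eq_right h0, zero_rpow hp.ne', sub_zero]
        have : (t - τ) ^ p = (t - τ) ^ (p - 1) * (t - τ) := by
          rw [rpow_sub_one ht.ne']; field_simp
        rw [this]
        gcongr
        linarith
      · rw [max_eq_left h0.le]
        have := rpow_sub_rpow_le_mul_rpow_sub_one hp1 h0 (by linarith : s - τ ≤ t - τ)
        nlinarith
    · have h0 : 0 < s - τ := by linarith
      rw [max_eq_left h0.le]
      have hle : (t - τ) ^ p ≤ (s - τ) ^ p := rpow_le_rpow ht.le (by linarith) hp.le
      rw [abs_of_nonneg (sub_nonneg.2 hle), abs_of_nonneg (sub_nonneg.2 hst)]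
      have h1 := rpow_sub_rpow_le_mul_rpow_sub_one hp1 ht (by linarith : t - τ ≤ s - τ)
      have h2 : (s - τ) ^ (p - 1) ≤ (t - τ) ^ (p - 1) :=
        rpow_le_rpow_of_nonpos ht (by linarith) (by linarith)
      nlinarith [mul_le_mul_of_nonneg_left h2 (sub_nonneg.2 hst)]
  · rw [max_eq_right (by linarith : t - τ ≤ 0), zero_rpow hp.ne', sub_zero]
    rcases le_or_gt (s - τ) 0 with h0 | h0
    · rwa [max_eq_right h0, zero_rpow hp.ne', abs_zero]
    · have hst : 0 < s - t := by linarith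
      rw [max_eq_left h0.le, abs_of_nonneg (rpow_nonneg h0.le _), abs_sub_comm t τ,
        abs_of_pos (sub_pos.2 h), abs_of_pos hst]
      have h1 : (s - τ) ^ p ≤ (s - t) ^ p := rpow_le_rpow h0.le (by linarith) hp.le
      have h2 : (s - t) ^ p = (s - t) ^ (p - 1) * (s - t) := by
        rw [rpow_sub_one hst.ne']; field_simp
      have h3 : (s - t) ^ (p - 1) ≤ (τ - t) ^ (p - 1) :=
        rpow_le_rpow_of_nonpos (sub_pos.2 h) (by linarith) (by linarith)
      rw [h2] at h1
      exact h1.trans (mul_le_mul_of_nonneg_right h3 hst.le)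

theorem abs_rpow_mul_log_le {m r u L : ℝ} (hm : 0 < m) (hr : r ∈ Icc m 1) (hu : 0 < u)
    (huL : u ≤ L) : |u ^ r * log u| ≤ 1 / m + L ^ 2 := by
  have hr0 : 0 < r := hm.trans_le hr.1
  rcases le_total u 1 with h1 | h1
  · have h := (abs_log_mul_self_rpow_lt u r hu h1 hr0).le
    rw [mul_comm] at h
    have h2 : 1 / r ≤ 1 / m := one_div_le_one_div_of_le hm hr.1
    nlinarith [sq_nonneg L]
  · have h2 : u ^ r ≤ u := by simpa using rpow_le_rpow_of_exponent_le h1 hr.2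
    have h3 : log u ≤ u := (log_le_sub_one_of_pos hu).trans (by linarith)
    have h4 : 0 ≤ log u := log_nonneg h1
    rw [abs_of_nonneg (by positivity)]
    have h5 : u ^ r * log u ≤ u * u := mul_le_mul h2 h3 h4 hu.le
    have : 0 < 1 / m := by positivity
    nlinarith

theorem abs_rpow_sub_rpow_le_of_exponents {m r r' u L : ℝ} (hm : 0 < m) (hr : r ∈ Icc m 1)
    (hr' : r' ∈ Icc m 1) (hu : 0 ≤ u) (huL : u ≤ L) :
    |u ^ r' - u ^ r| ≤ (1 / m + L ^ 2) * |r' - r| := by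
  rcases hu.eq_or_lt with rfl | hu
  · rw [zero_rpow (hm.trans_le hr.1).ne', zero_rpow (hm.trans_le hr'.1).ne', sub_zero, abs_zero]
    positivity
  · refine (convex_Icc m 1).norm_image_sub_le_of_norm_hasDerivWithin_le
      (f := fun y ↦ u ^ y) (f' := fun y ↦ u ^ y * log u) (fun y _ ↦ ?_)
      (fun y hy ↦ abs_rpow_mul_log_le hm hy hu huL) hr hr'
    exact (hasStrictDerivAt_const_rpow hu y).hasDerivAt.hasDerivWithinAt

theorem intervalIntegrable_abs_rpow {r : ℝ} (hr : -1 < r) (a b : ℝ) :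
    IntervalIntegrable (fun u : ℝ ↦ |u| ^ r) volume a b := by
  refine intervalIntegrable_of_even (fun u ↦ by rw [abs_neg]) (fun u hu ↦ ?_)
  refine (intervalIntegrable_rpow' hr (a := 0) (b := u)).congr ?_
  intro v hv
  rw [uIoc_of_le hu.le] at hv
  simp only [abs_of_pos hv.1]

theorem setIntegral_Ioc_eq_intervalIntegral {a b s : ℝ} {G f : ℝ → ℝ} (hs : s ∈ Icc a b)
    (hG : ∀ τ, s ≤ τ → G τ = 0) (hf : ∀ τ < s, G τ = f τ) :
    ∫ τ in Ioc a b, G τ = ∫ τ in a..s, f τ := by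
  rw [intervalIntegral.integral_of_le hs.1, integral_Ioc_eq_integral_Ioo (x := a) (y := s),
    ← setIntegral_congr_fun measurableSet_Ioo (fun τ hτ ↦ hf τ hτ.2)]
  refine setIntegral_eq_of_subset_of_forall_sdiff_eq_zero measurableSet_Ioc
    (fun τ hτ ↦ ⟨hτ.1, hτ.2.le.trans hs.2⟩) (fun τ hτ ↦ hG τ ?_)
  by_contra! h
  exact hτ.2 ⟨hτ.1.1, h⟩

theorem intervalIntegrable_sub_rpow {r : ℝ} (hr : -1 < r) (a s : ℝ) :
    IntervalIntegrable (fun τ ↦ (s - τ) ^ r) volume a s := by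
  simpa using (intervalIntegrable_rpow' hr (a := s - a) (b := 0)).comp_sub_left s

/-- The Riemann-Liouville type integral with variable exponent, differentiated in its upper
limit. -/
theorem hasDerivAt_integral_sub_rpow_mul {a b t q' : ℝ} {q g : ℝ → ℝ}
    (hg : ContinuousOn g (Icc a b)) (ht : t ∈ Ioo a b) (hq : HasDerivAt q q' t)
    (hp : 0 < q t) (hp1 : q t < 1) :
    HasDerivAt (fun s ↦ ∫ τ in a..s, (s - τ) ^ (q s) * g τ)
      (∫ τ in a..t, (q t * (t - τ) ^ (q t - 1) + q' * (t - τ) ^ (q t) * log (t - τ)) * g τ)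
      t := by
  obtain ⟨M, hM⟩ := isCompact_Icc.exists_bound_of_continuousOn hg
  have hg_meas : AEStronglyMeasurable g (volume.restrict (Ioc a b)) :=
    (hg.aestronglyMeasurable measurableSet_Icc).mono_measure
      (Measure.restrict_mono Ioc_subset_Icc_self le_rfl)
  have hab : a ≤ b := (ht.1.trans ht.2).le
  obtain ⟨K, hK⟩ := hq.isBigO_sub.bound
  set C : ℝ := (1 / (q t / 2) + (b - a) ^ 2) * K with hC
  set S : Set ℝ := {s | s ∈ Ioo a b ∧ q s ∈ Icc (q t / 2) 1 ∧ ‖q s - q t‖ ≤ K * ‖s - t‖}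
  have hS_mem : S ∈ 𝓝 t := by
    refine inter_mem (Ioo_mem_nhds ht.1 ht.2) (inter_mem ?_ hK)
    exact hq.continuousAt (Icc_mem_nhds (by linarith) hp1)
  have hne : ∀ᵐ τ ∂(volume.restrict (Ioc a b)), τ ≠ t := Measure.ae_ne _ t
  have hmem : ∀ᵐ τ ∂(volume.restrict (Ioc a b)), τ ∈ Ioc a b :=
    ae_restrict_mem measurableSet_Ioc
  have hq1 : q t - 1 ≠ 0 := by linarith
  have key := hasDerivAt_integral_of_dominated_loc_of_lip_base
    (μ := volume.restrict (Ioc a b)) (x₀ := t) (s := S)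
    (F := fun s τ ↦ (max (s - τ) 0) ^ (q s) * g τ)
    (F' := fun τ ↦ (q t * (max (t - τ) 0) ^ (q t - 1) +
      q' * (max (t - τ) 0) ^ (q t) * log (max (t - τ) 0)) * g τ)
    (bound := fun τ ↦ (C + |t - τ| ^ (q t - 1)) * M) hS_mem
    (fun s _ ↦ AEStronglyMeasurable.mul (Measurable.aestronglyMeasurable (by fun_prop)) hg_meas) ?_
    (AEStronglyMeasurable.mul (Measurable.aestronglyMeasurable (by fun_prop)) hg_meas) ?_ ?_ ?_
  · have h_int := setIntegral_Ioc_eq_intervalIntegral (Ioo_subset_Icc_self ht)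
      (G := fun τ ↦ (q t * (max (t - τ) 0) ^ (q t - 1) +
        q' * (max (t - τ) 0) ^ (q t) * log (max (t - τ) 0)) * g τ)
      (f := fun τ ↦ (q t * (t - τ) ^ (q t - 1) + q' * (t - τ) ^ (q t) * log (t - τ)) * g τ)
      (fun τ hτ ↦ by simp [max_eq_right (sub_nonpos.2 hτ), zero_rpow hq1])
      (fun τ hτ ↦ by simp [max_eq_left (sub_pos.2 hτ).le])
    rw [h_int] at key
    refine key.congr_of_eventuallyEq ?_
    filter_upwards [hS_mem] with s hs
    exact (setIntegral_Ioc_eq_intervalIntegral (Ioo_subset_Icc_self hs.1)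
      (fun τ hτ ↦ by
        rw [max_eq_right (sub_nonpos.2 hτ), zero_rpow (by linarith [hs.2.1.1]), zero_mul])
      (fun τ hτ ↦ by rw [max_eq_left (sub_pos.2 hτ).le])).symm
  · refine Integrable.bdd_mul (c := (b - a) ^ (q t))
      ((hg.integrableOn_Icc).mono_set Ioc_subset_Icc_self) (Measurable.aestronglyMeasurable (by fun_prop)) ?_
    filter_upwards [hmem] with τ hτ
    rw [norm_of_nonneg (by positivity)]
    exact rpow_le_rpow (le_max_right _ _)
      (max_le (by linarith [ht.2, hτ.1]) (by linarith)) hp.le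
  · filter_upwards [hne, hmem] with τ hτ hτ' s hs
    have h1 := abs_max_rpow_sub_max_rpow_le (s := s) hp hp1.le hτ
    have h2 := abs_rpow_sub_rpow_le_of_exponents (m := q t / 2) (r := q t) (r' := q s)
      (u := max (s - τ) 0) (L := b - a) (by linarith) ⟨by linarith, hp1.le⟩ hs.2.1
      (le_max_right _ _) (max_le (by linarith [hs.1.2, hτ'.1]) (by linarith))
    have h3 : (1 / (q t / 2) + (b - a) ^ 2) * |q s - q t| ≤ C * |s - t| := by
      rw [hC, mul_assoc]
      exact mul_le_mul_of_nonneg_left hs.2.2 (by positivity)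
    rw [← sub_mul, norm_mul, mul_right_comm]
    refine mul_le_mul ?_ (hM τ (Ioc_subset_Icc_self hτ')) (norm_nonneg _) ?_
    · rw [Real.norm_eq_abs, Real.norm_eq_abs, add_mul]
      exact (abs_sub_le _ ((max (s - τ) 0) ^ (q t)) _).trans (add_le_add (h2.trans h3) h1)
    · have h4 : 0 ≤ C * |s - t| := le_trans (by positivity) h3
      rw [Real.norm_eq_abs, add_mul]
      positivity
  · have h := (intervalIntegrable_abs_rpow (r := q t - 1) (by linarith) (t - a)
      (t - b)).comp_sub_left t
    simp only [sub_sub_cancel] at h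
    exact ((integrable_const C).add
      ((intervalIntegrable_iff_integrableOn_Ioc_of_le hab).1 h)).mul_const M
  · filter_upwards [hne] with τ hτ
    refine HasDerivAt.mul_const ?_ _
    rcases lt_or_gt_of_ne hτ with h | h
    · have h0 : 0 < t - τ := sub_pos.2 h
      rw [max_eq_left h0.le]
      have hd := ((hasDerivAt_id t).sub_const τ).rpow hq h0
      rw [one_mul] at hd
      refine hd.congr_of_eventuallyEq ?_
      filter_upwards [Ioi_mem_nhds h] with s hs
      simp [max_eq_left (sub_pos.2 (mem_Ioi.1 hs)).le]
    · rw [max_eq_right (by linarith : t - τ ≤ 0), zero_rpow hq1, zero_rpow hp.ne']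
      simp only [mul_zero, zero_mul, add_zero]
      refine (hasDerivAt_const t (0 : ℝ)).congr_of_eventuallyEq ?_
      filter_upwards [Iio_mem_nhds h, hS_mem] with s hs hs'
      rw [max_eq_right (by linarith [mem_Iio.1 hs] : s - τ ≤ 0),
        zero_rpow (by linarith [hs'.2.1.1])]

theorem integral_sub_rpow_neg_mul_sub {a b s r : ℝ} {x : ℝ → ℝ}
    (hx : ContDiffOn ℝ 1 x (Icc a b)) (hs : s ∈ Ioo a b) (hr1 : r < 1) :
    ∫ τ in a..s, (s - τ) ^ (-r) * (x τ - x a) =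
      1 / (1 - r) * ∫ τ in a..s, (s - τ) ^ (1 - r) * derivWithin x (Icc a b) τ := by
  have hr0 : 1 - r ≠ 0 := by linarith
  have hab : a < b := hs.1.trans hs.2
  have hsub : uIcc a s ⊆ Icc a b := by
    rw [uIcc_of_le hs.1.le]
    exact Icc_subset_Icc_right hs.2.le
  have hg : ContinuousOn (derivWithin x (Icc a b)) (Icc a b) :=
    hx.continuousOn_derivWithin (uniqueDiffOn_Icc hab) le_rfl
  have hparts := integral_mul_deriv_eq_deriv_mul_of_hasDerivAt (a := a) (b := s)
    (u := fun τ ↦ x τ - x a) (u' := derivWithin x (Icc a b))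
    (v := fun τ ↦ -((s - τ) ^ (1 - r) / (1 - r))) (v' := fun τ ↦ (s - τ) ^ (-r))
    ((hx.continuousOn.mono hsub).sub continuousOn_const)
    (((continuousOn_const.sub continuousOn_id).rpow_const
      (fun _ _ ↦ Or.inr (by linarith))).div_const _).neg ?_ ?_
    ((hg.mono hsub).intervalIntegrable) (intervalIntegrable_sub_rpow (by linarith) a s)
  · simp only [sub_self, zero_rpow hr0, zero_div, neg_zero, mul_zero, zero_mul, zero_sub] at hparts
    simp_rw [mul_comm _ (x _ - x a)]
    rw [hparts, ← intervalIntegral.integral_neg, ← intervalIntegral.integral_const_mul]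
    refine intervalIntegral.integral_congr fun τ _ ↦ ?_
    ring
  · intro τ hτ
    rw [min_eq_left hs.1.le, max_eq_right hs.1.le] at hτ
    have hmem : Icc a b ∈ 𝓝 τ := Icc_mem_nhds hτ.1 (hτ.2.trans hs.2)
    exact ((hx.differentiableOn one_ne_zero τ
      (mem_of_mem_nhds hmem)).hasDerivWithinAt.hasDerivAt hmem).sub_const _
  · intro τ hτ
    rw [max_eq_right hs.1.le] at hτ
    have h0 : s - τ ≠ 0 := (sub_pos.2 hτ.2).ne'
    have h := ((((hasDerivAt_id τ).const_sub s).rpow_const (p := 1 - r)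
      (Or.inl h0)).div_const (1 - r)).neg
    refine h.congr_deriv ?_
    rw [show 1 - r - 1 = -r by ring, id]
    field_simp

/-- Type I left Caputo derivative of variable order equals the type III derivative
plus a correction term involving α'. -/
theorem caputo_typeI_eq_typeIII_add_correction
    (a b : ℝ) (hab : a < b) (x α : ℝ → ℝ)
    (hx : ContDiffOn ℝ 1 x (Set.Icc a b))
    (hα : DifferentiableOn ℝ α (Set.Icc a b))
    (hα01 : ∀ s ∈ Set.Icc a b, α s ∈ Set.Ioo (0 : ℝ) 1)
    (t : ℝ) (ht : t ∈ Set.Ioo a b) :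
    (1 / Real.Gamma (1 - α t)) *
        deriv (fun s => ∫ τ in a..s, (s - τ) ^ (-(α s)) * (x τ - x a)) t =
      (1 / Real.Gamma (1 - α t)) * (∫ τ in a..t, (t - τ) ^ (-(α t)) * deriv x τ) +
        (deriv α t / Real.Gamma (2 - α t)) *
          ∫ τ in a..t, (t - τ) ^ (1 - α t) * deriv x τ *
            (1 / (1 - α t) - Real.log (t - τ)) := by
  set g := derivWithin x (Icc a b)
  have hg : ContinuousOn g (Icc a b) :=
    hx.continuousOn_derivWithin (uniqueDiffOn_Icc hab) le_rfl
  have ht01 := hα01 t (Ioo_subset_Icc_self ht)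
  have hp : 0 < 1 - α t := by linarith [ht01.2]
  have hαt : HasDerivAt α (deriv α t) t :=
    (hα.differentiableAt (Icc_mem_nhds ht.1 ht.2)).hasDerivAt
  have hq : HasDerivAt (fun s ↦ 1 - α s) (-deriv α t) t := hαt.const_sub 1
  have hmain := (hq.inv hp.ne').mul (hasDerivAt_integral_sub_rpow_mul hg ht hq hp
    (by linarith [ht01.1]))
  have hEq : (fun s ↦ ∫ τ in a..s, (s - τ) ^ (-(α s)) * (x τ - x a)) =ᶠ[𝓝 t]
      (fun s ↦ 1 - α s)⁻¹ * fun s ↦ ∫ τ in a..s, (s - τ) ^ (1 - α s) * g τ := by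
    filter_upwards [Ioo_mem_nhds ht.1 ht.2] with s hs
    rw [integral_sub_rpow_neg_mul_sub hx hs (hα01 s (Ioo_subset_Icc_self hs)).2, one_div]
    rfl
  rw [hEq.deriv_eq, hmain.deriv]
  have hderiv : ∀ τ ∈ Ioo a t, deriv x τ = g τ := fun τ hτ ↦
    (derivWithin_of_mem_nhds (Icc_mem_nhds hτ.1 (hτ.2.trans ht.2))).symm
  have hcongr : ∀ {f₁ f₂ : ℝ → ℝ}, (∀ τ ∈ Ioo a t, f₁ τ = f₂ τ) →
      ∫ τ in a..t, f₁ τ = ∫ τ in a..t, f₂ τ := fun h ↦ by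
    rw [intervalIntegral.integral_of_le ht.1.le, intervalIntegral.integral_of_le ht.1.le,
      integral_Ioc_eq_integral_Ioo, integral_Ioc_eq_integral_Ioo]
    exact setIntegral_congr_fun measurableSet_Ioo h
  have hgt : ContinuousOn g (uIcc a t) := hg.mono <| by
    rw [uIcc_of_le ht.1.le]
    exact Icc_subset_Icc_right ht.2.le
  have hpow : ContinuousOn (fun τ ↦ (t - τ) ^ (1 - α t)) (uIcc a t) :=
    (continuousOn_const.sub continuousOn_id).rpow_const fun _ _ ↦ Or.inr hp.le
  have hI₁ : IntervalIntegrable (fun τ ↦ (t - τ) ^ (-α t) * g τ) volume a t :=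
    (intervalIntegrable_sub_rpow (by linarith) a t).mul_continuousOn hgt
  have hI₂ : IntervalIntegrable (fun τ ↦ (t - τ) ^ (1 - α t) * g τ) volume a t :=
    (hpow.mul hgt).intervalIntegrable
  have hI₃ : IntervalIntegrable (fun τ ↦ (t - τ) ^ (1 - α t) * g τ * log (t - τ))
      volume a t := by
    have h := (intervalIntegrable_log' (a := t - a) (b := 0)).comp_sub_left t
    simp only [sub_sub_cancel, sub_zero] at h
    exact h.continuousOn_mul (hpow.mul hgt)
  have hJ₁ : ∫ τ in a..t, (t - τ) ^ (-α t) * deriv x τ =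
      ∫ τ in a..t, (t - τ) ^ (-α t) * g τ := hcongr fun τ hτ ↦ by rw [hderiv τ hτ]
  have hJ₂ : ∫ τ in a..t, (t - τ) ^ (1 - α t) * deriv x τ * (1 / (1 - α t) - log (t - τ)) =
      1 / (1 - α t) * (∫ τ in a..t, (t - τ) ^ (1 - α t) * g τ) -
        ∫ τ in a..t, (t - τ) ^ (1 - α t) * g τ * log (t - τ) := by
    rw [← intervalIntegral.integral_const_mul,
      ← intervalIntegral.integral_sub (hI₂.const_mul _) hI₃]
    exact hcongr fun τ hτ ↦ by rw [hderiv τ hτ]; ring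
  have hJ₃ : ∫ τ in a..t, ((1 - α t) * (t - τ) ^ (1 - α t - 1) +
        -deriv α t * (t - τ) ^ (1 - α t) * log (t - τ)) * g τ =
      (1 - α t) * (∫ τ in a..t, (t - τ) ^ (-α t) * g τ) -
        deriv α t * ∫ τ in a..t, (t - τ) ^ (1 - α t) * g τ * log (t - τ) := by
    rw [← intervalIntegral.integral_const_mul, ← intervalIntegral.integral_const_mul,
      ← intervalIntegral.integral_sub (hI₁.const_mul _) (hI₃.const_mul _)]
    exact hcongr fun τ _ ↦ by rw [show 1 - α t - 1 = -α t by ring]; ring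
  have hΓ : Gamma (1 - α t) ≠ 0 := (Gamma_pos_of_pos hp).ne'
  rw [hJ₁, hJ₂, hJ₃, Pi.inv_apply, show 2 - α t = (1 - α t) + 1 by ring, Gamma_add_one hp.ne']
  field_simp
  ring
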